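/- Let G be a finite simple graph with maximum degree Δ ≥ 1 and adjacency matrix A over ℝ, and let λ_min denote the smallest eigenvalue of the (real symmetric) matrix A. Then λ_min < 0 and the critical coupling satisfies 1/Δ ≤ τ_c(G) ≤ −1/λ_min. -/

import Mathlib

open Matrix

/-- The critical coupling of a finite simple graph `G`:
`τ_c(G) = sSup {t | 0 ≤ t ∧ ∀ τ ∈ [0, t), I + τ•A is invertible and
(I + τ•A)⁻¹ *ᵥ 𝟙 has all entries strictly positive}`. -/
noncomputable def criticalCoupling {V : Type*} [Fintype V] [DecidableEq V]
    (G : SimpleGraph V) [DecidableRel G.Adj] : ℝ :=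
  sSup {t : ℝ | 0 ≤ t ∧ ∀ τ ∈ Set.Ico (0 : ℝ) t,
    IsUnit (1 + τ • G.adjMatrix ℝ) ∧
    ∀ i, 0 < ((1 + τ • G.adjMatrix ℝ)⁻¹ *ᵥ fun _ => (1 : ℝ)) i}


lemma cc_isUnit {V : Type*} [Fintype V] [DecidableEq V]
    (G : SimpleGraph V) [DecidableRel G.Adj] (τ : ℝ) (h0 : 0 ≤ τ)
    (h1 : τ * (G.maxDegree : ℝ) < 1) : IsUnit (1 + τ • G.adjMatrix ℝ) := by
  rw [Matrix.isUnit_iff_isUnit_det, isUnit_iff_ne_zero]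
  apply det_ne_zero_of_sum_row_lt_diag
  intro k
  have hd : ‖(1 + τ • G.adjMatrix ℝ) k k‖ = 1 := by simp
  rw [hd]
  have hs : ∑ j ∈ Finset.univ.erase k, ‖(1 + τ • G.adjMatrix ℝ) k j‖
      = ∑ j ∈ Finset.univ.erase k, τ * G.adjMatrix ℝ k j := by
    apply Finset.sum_congr rfl
    intro j hj
    have hkj : k ≠ j := fun h => (Finset.ne_of_mem_erase hj) h.symm
    rw [Matrix.add_apply, Matrix.one_apply_ne hkj, Matrix.smul_apply, zero_add, smul_eq_mul,
      Real.norm_of_nonneg]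
    apply mul_nonneg h0
    rw [SimpleGraph.adjMatrix_apply]
    split_ifs <;> norm_num
  rw [hs, ← Finset.mul_sum]
  have hle : ∑ j ∈ Finset.univ.erase k, G.adjMatrix ℝ k j ≤ (G.maxDegree : ℝ) := by
    calc ∑ j ∈ Finset.univ.erase k, G.adjMatrix ℝ k j ≤ ∑ j, G.adjMatrix ℝ k j := by
          apply Finset.sum_le_sum_of_subset_of_nonneg (Finset.erase_subset _ _)
          intro j _ _
          rw [SimpleGraph.adjMatrix_apply]
          split_ifs <;> norm_num
      _ = (G.degree k : ℝ) := by
          have := G.adjMatrix_mulVec_const_apply (α := ℝ) (a := 1) (v := k)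
          simpa [Matrix.mulVec, dotProduct] using this
      _ ≤ _ := by exact_mod_cast G.degree_le_maxDegree k
  exact lt_of_le_of_lt (mul_le_mul_of_nonneg_left hle h0) h1

lemma cc_pos {V : Type*} [Fintype V] [DecidableEq V]
    (G : SimpleGraph V) [DecidableRel G.Adj] (τ : ℝ) (h0 : 0 ≤ τ)
    (h1 : τ * (G.maxDegree : ℝ) < 1) (x : V → ℝ)
    (hx : (1 + τ • G.adjMatrix ℝ) *ᵥ x = fun _ => (1 : ℝ)) (i : V) : 0 < x i := by
  have : Nonempty V := ⟨i⟩
  have hx' : ∀ k, x k = 1 - τ * ∑ j ∈ G.neighborFinset k, x j := by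
    intro k
    have := congrFun hx k
    rw [Matrix.add_mulVec, Matrix.one_mulVec, Matrix.smul_mulVec, Pi.add_apply, Pi.smul_apply,
      SimpleGraph.adjMatrix_mulVec_apply, smul_eq_mul] at this
    linarith
  obtain ⟨a, ha⟩ := Finite.exists_min x
  obtain ⟨b, hb⟩ := Finite.exists_max x
  refine lt_of_lt_of_le ?_ (ha i)
  by_contra! hm
  have hdeg : ∀ k, (G.degree k : ℝ) ≤ G.maxDegree := fun k => by
    exact_mod_cast G.degree_le_maxDegree k
  have hup : ∑ j ∈ G.neighborFinset a, x j ≤ (G.degree a : ℝ) * x b := by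
    have := Finset.sum_le_card_nsmul (G.neighborFinset a) x (x b) (fun j _ => hb j)
    simpa using this
  have hlo : (G.degree b : ℝ) * x a ≤ ∑ j ∈ G.neighborFinset b, x j := by
    have := Finset.card_nsmul_le_sum (G.neighborFinset b) x (x a) (fun j _ => ha j)
    simpa using this
  have hlo2 : (G.maxDegree : ℝ) * x a ≤ ∑ j ∈ G.neighborFinset b, x j :=
    le_trans (mul_le_mul_of_nonpos_right (hdeg b) hm) hlo
  have hda : (0 : ℝ) ≤ G.degree a := Nat.cast_nonneg _
  have hΔ0 : (0 : ℝ) ≤ G.maxDegree := Nat.cast_nonneg _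
  have hXpos : 0 ≤ x b := by
    by_contra! hX
    have h2 : ∑ j ∈ G.neighborFinset a, x j ≤ 0 :=
      hup.trans (mul_nonpos_of_nonneg_of_nonpos hda hX.le)
    have := mul_nonpos_of_nonneg_of_nonpos h0 h2
    linarith [hx' a]
  have hup2 : ∑ j ∈ G.neighborFinset a, x j ≤ (G.maxDegree : ℝ) * x b :=
    hup.trans (mul_le_mul_of_nonneg_right (hdeg a) hXpos)
  have e1 := mul_le_mul_of_nonneg_left hup2 h0
  have e2 := mul_le_mul_of_nonneg_left hlo2 h0
  rw [← mul_assoc] at e1 e2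
  have ea := hx' a
  have eb := hx' b
  set s := τ * (G.maxDegree : ℝ) with hs
  have hs0 : 0 ≤ s := mul_nonneg h0 hΔ0
  have e3 : x b ≤ 1 - s * x a := by linarith
  have e4 : 1 - s * x b ≤ x a := by linarith
  have e5 := mul_le_mul_of_nonneg_left e3 hs0
  have e6 : (1 - s) ≤ x a * ((1 - s) * (1 + s)) := by nlinarith
  have e7 : x a * ((1 - s) * (1 + s)) ≤ 0 :=
    mul_nonpos_of_nonpos_of_nonneg hm (mul_nonneg (by linarith) (by linarith))
  linarith

lemma cc_lambda_neg {V : Type*} [Fintype V] [DecidableEq V]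
    [Nonempty V] (G : SimpleGraph V) [DecidableRel G.Adj] (hΔ : 1 ≤ G.maxDegree)
    (hA : (G.adjMatrix ℝ).IsHermitian) :
    (⨅ i, hA.eigenvalues i) < 0 := by
  by_contra! h
  have hnn : ∀ i, 0 ≤ hA.eigenvalues i := fun i =>
    h.trans (ciInf_le (Set.finite_range _).bddBelow i)
  have htr := hA.trace_eq_sum_eigenvalues
  rw [SimpleGraph.trace_adjMatrix] at htr
  have hz : ∑ i, hA.eigenvalues i = 0 := by simpa using htr.symm
  have hz' : hA.eigenvalues = 0 := by
    funext i
    exact (Finset.sum_eq_zero_iff_of_nonneg (fun i _ => hnn i)).1 hz i (Finset.mem_univ i)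
  have hA0 := hA.eigenvalues_eq_zero_iff.1 hz'
  obtain ⟨v, hv⟩ := G.exists_maximal_degree_vertex
  have hpos : 0 < G.degree v := by omega
  obtain ⟨w, hw⟩ := (G.degree_pos_iff_exists_adj v).1 hpos
  have := congrFun (congrFun hA0 v) w
  simp [SimpleGraph.adjMatrix_apply, hw] at this

/-- For a finite simple graph with maximum degree `Δ ≥ 1`, the least eigenvalue
`λ_min` of its (real symmetric) adjacency matrix satisfies `λ_min < 0`, and
`1/Δ ≤ τ_c(G) ≤ -1/λ_min`. -/
theorem criticalCoupling_le_neg_inv_lambdaMin {V : Type*} [Fintype V] [DecidableEq V]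
    [Nonempty V] (G : SimpleGraph V) [DecidableRel G.Adj] (hΔ : 1 ≤ G.maxDegree)
    (hA : (G.adjMatrix ℝ).IsHermitian) :
    (⨅ i, hA.eigenvalues i) < 0 ∧
      1 / (G.maxDegree : ℝ) ≤ criticalCoupling G ∧
      criticalCoupling G ≤ -1 / (⨅ i, hA.eigenvalues i) := by
  have hneg := cc_lambda_neg G hΔ hA
  have hΔ' : (0 : ℝ) < G.maxDegree := by exact_mod_cast hΔ
  have hub : ∀ t ∈ {t : ℝ | 0 ≤ t ∧ ∀ τ ∈ Set.Ico (0 : ℝ) t,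
      IsUnit (1 + τ • G.adjMatrix ℝ) ∧
      ∀ i, 0 < ((1 + τ • G.adjMatrix ℝ)⁻¹ *ᵥ fun _ => (1 : ℝ)) i},
      t ≤ -1 / (⨅ i, hA.eigenvalues i) := by
    rintro t ⟨_, ht⟩
    by_contra! hlt
    obtain ⟨i, hi⟩ := exists_eq_ciInf_of_finite (f := hA.eigenvalues)
    rw [← hi] at hlt hneg
    have hu := (ht (-1 / hA.eigenvalues i)
      ⟨div_nonneg_of_nonpos (by norm_num) hneg.le, hlt⟩).1
    have hinj := Matrix.mulVec_injective_iff_isUnit.2 hu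
    have hne : hA.eigenvectorBasis i ≠ 0 := hA.eigenvectorBasis.orthonormal.ne_zero i
    apply hne
    have hv := hA.mulVec_eigenvectorBasis i
    ext k
    refine congrFun (@hinj (⇑(hA.eigenvectorBasis i)) 0 ?_) k
    simp only [Matrix.mulVec_zero]
    rw [Matrix.add_mulVec, Matrix.one_mulVec, Matrix.smul_mulVec, hv, smul_smul,
      div_mul_cancel₀ _ hneg.ne]
    simp
  refine ⟨hneg, ?_, ?_⟩
  · apply le_csSup ⟨_, hub⟩
    refine ⟨by positivity, ?_⟩
    rintro τ ⟨h0, h1⟩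
    have h1' : τ * (G.maxDegree : ℝ) < 1 := (lt_div_iff₀ hΔ').1 h1
    have hu := cc_isUnit G τ h0 h1'
    refine ⟨hu, cc_pos G τ h0 h1' _ ?_⟩
    rw [Matrix.mulVec_mulVec, Matrix.mul_nonsing_inv _ ((Matrix.isUnit_iff_isUnit_det _).1 hu),
      Matrix.one_mulVec]
  · refine csSup_le ?_ hub
    refine ⟨0, le_refl _, ?_⟩
    rintro τ ⟨h0, h1⟩
    exact absurd h1 (not_lt.2 h0)
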